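/- arXiv:1610.03605 — 8 statements merged into one kernel-verified Lean document; each statement's English description precedes it below -/
import Mathlib

section
/- Let V be a finite-dimensional complex normed vector space and let P, Q : V → V be continuous linear idempotents (P ∘ P = P and Q ∘ Q = Q), i.e. projectors, such that the operator norm ‖P − Q‖ < 1. Then the rank of P equals the rank of Q, i.e. finrank(range P) = finrank(range Q). -/
theorem finrank_range_le_of_norm_sub_lt_one
    {𝕜 V : Type*} [NontriviallyNormedField 𝕜] [NormedAddCommGroup V] [NormedSpace 𝕜 V]
    [FiniteDimensional 𝕜 V] {P Q : V →L[𝕜] V} (hP : P ∘L P = P) (hPQ : ‖P - Q‖ < 1) :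
    Module.finrank 𝕜 (LinearMap.range (P : V →ₗ[𝕜] V)) ≤
      Module.finrank 𝕜 (LinearMap.range (Q : V →ₗ[𝕜] V)) := by
  let f := (Q : V →ₗ[𝕜] V).rangeRestrict ∘ₗ (LinearMap.range (P : V →ₗ[𝕜] V)).subtype
  refine LinearMap.finrank_le_finrank_of_injective (f := f) ?_
  rw [injective_iff_map_eq_zero]
  rintro ⟨_, w, rfl⟩ hw
  have hQ : Q (P w) = 0 := congrArg Subtype.val hw
  have hPP : P (P w) = P w := DFunLike.congr_fun hP w
  have hle : ‖P w‖ ≤ ‖P - Q‖ * ‖P w‖ := by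
    simpa [hQ, hPP] using (P - Q).le_opNorm (P w)
  have hzero : ‖P w‖ = 0 := by
    nlinarith [norm_nonneg (P w)]
  exact Subtype.ext (norm_eq_zero.mp hzero)

theorem projectors_close_same_rank
    {V : Type*} [NormedAddCommGroup V] [NormedSpace ℂ V] [FiniteDimensional ℂ V]
    (P Q : V →L[ℂ] V)
    (hP : P ∘L P = P) (hQ : Q ∘L Q = Q)
    (hPQ : ‖P - Q‖ < 1) :
    Module.finrank ℂ (LinearMap.range (P : V →ₗ[ℂ] V)) =
      Module.finrank ℂ (LinearMap.range (Q : V →ₗ[ℂ] V)) :=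
  le_antisymm (finrank_range_le_of_norm_sub_lt_one hP hPQ)
    (finrank_range_le_of_norm_sub_lt_one hQ (norm_sub_rev P Q ▸ hPQ))
end

section
/- Let V be a finite-dimensional complex normed vector space and let P, Q : V → V be continuous linear idempotents with operator norm ‖P − Q‖ < 1. Then rank(P ∘ Q) = rank(P), i.e. finrank(range(P ∘ Q)) = finrank(range P). -/
theorem ContinuousLinearMap.range_one_sub_eq_top_of_norm_lt_one
    {𝕜 V : Type*} [NontriviallyNormedField 𝕜] [NormedAddCommGroup V] [NormedSpace 𝕜 V]
    [CompleteSpace V] {T : V →L[𝕜] V} (hT : ‖T‖ < 1) :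
    LinearMap.range ((1 - T : V →L[𝕜] V) : V →ₗ[𝕜] V) = ⊤ := by
  obtain ⟨S, hS⟩ := (isUnit_one_sub_of_norm_lt_one hT).exists_right_inv
  exact LinearMap.range_eq_top.2 fun x => ⟨S x, DFunLike.congr_fun hS x⟩

theorem ContinuousLinearMap.range_comp_eq_range_of_norm_sub_lt_one
    {𝕜 V : Type*} [NontriviallyNormedField 𝕜] [NormedAddCommGroup V] [NormedSpace 𝕜 V]
    [CompleteSpace V] {P Q : V →L[𝕜] V} (hP : P ∘L P = P) (hPQ : ‖P - Q‖ < 1) :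
    LinearMap.range ((P ∘L Q) : V →ₗ[𝕜] V) = LinearMap.range (P : V →ₗ[𝕜] V) := by
  have h : P ∘L Q = P ∘L (1 - (P - Q)) := by
    change P * Q = P * (1 - (P - Q))
    rw [mul_sub, mul_sub, show P * P = P from hP, mul_one, sub_sub_cancel]
  rw [h]
  exact LinearMap.range_comp_of_range_eq_top _ (range_one_sub_eq_top_of_norm_lt_one hPQ)

theorem rank_comp_eq_rank_of_projectors_close
    {V : Type*} [NormedAddCommGroup V] [NormedSpace ℂ V] [FiniteDimensional ℂ V]
    (P Q : V →L[ℂ] V)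
    (hP : P ∘L P = P) (hQ : Q ∘L Q = Q)
    (hPQ : ‖P - Q‖ < 1) :
    Module.finrank ℂ (LinearMap.range ((P ∘L Q) : V →ₗ[ℂ] V)) =
      Module.finrank ℂ (LinearMap.range (P : V →ₗ[ℂ] V)) := by
  have : CompleteSpace V := FiniteDimensional.complete ℂ V
  rw [ContinuousLinearMap.range_comp_eq_range_of_norm_sub_lt_one hP hPQ]
end

section
/- Fix real numbers θ and φ, set N = 1 + cos²(θ/2), λ₀ = (2/N)·cos⁴(θ/4), λ₁ = (2/N)·sin⁴(θ/4), and let M be the 2×2 complex matrix M = (1/(2N))·[[4cos²(θ/2) + sin²(θ/2), e^{iφ}·sin θ], [e^{−iφ}·sin θ, sin²(θ/2)]]. Then the characteristic polynomial of M factors as charpoly(M) = (X − λ₀)·(X − λ₁); equivalently, the eigenvalues of M are exactly λ₀ and λ₁ (with multiplicity). -/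
open Real Polynomial in
theorem charpoly_reduced_density_matrix (θ φ : ℝ)
    (N : ℝ) (hN : N = 1 + Real.cos (θ / 2) ^ 2)
    (lam₀ lam₁ : ℝ)
    (h₀ : lam₀ = (2 / N) * Real.cos (θ / 4) ^ 4)
    (h₁ : lam₁ = (2 / N) * Real.sin (θ / 4) ^ 4)
    (M : Matrix (Fin 2) (Fin 2) ℂ)
    (hM : M = (1 / (2 * N) : ℂ) •
      !![(4 * Real.cos (θ / 2) ^ 2 + Real.sin (θ / 2) ^ 2 : ℂ),
          Complex.exp (Complex.I * φ) * Real.sin θ;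
         Complex.exp (-(Complex.I * φ)) * Real.sin θ,
          (Real.sin (θ / 2) ^ 2 : ℂ)]) :
    M.charpoly = (X - C (lam₀ : ℂ)) * (X - C (lam₁ : ℂ)) := by
  have hN0 : N ≠ 0 := by rw [hN]; positivity
  have hNc : (N : ℂ) ≠ 0 := by exact_mod_cast hN0
  have hhalf : θ / 2 = 2 * (θ / 4) := by ring
  have hsq : Real.sin (θ / 2) ^ 2 = 1 - Real.cos (θ / 2) ^ 2 := Real.sin_sq _
  have hsin : Real.sin θ = 2 * Real.sin (θ / 2) * Real.cos (θ / 2) := by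
    rw [← Real.sin_two_mul]; congr 1; ring
  have hcos4 : Real.cos (θ / 4) ^ 2 = (1 + Real.cos (θ / 2)) / 2 := by
    rw [hhalf, Real.cos_two_mul]; ring
  have hsin4 : Real.sin (θ / 4) ^ 2 = (1 - Real.cos (θ / 2)) / 2 := by
    rw [Real.sin_sq, hcos4]; ring
  have hl₀ : lam₀ = (1 + Real.cos (θ / 2)) ^ 2 / (2 * N) := by
    rw [h₀, show Real.cos (θ / 4) ^ 4 = (Real.cos (θ / 4) ^ 2) ^ 2 by ring, hcos4]
    field_simp
  have hl₁ : lam₁ = (1 - Real.cos (θ / 2)) ^ 2 / (2 * N) := by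
    rw [h₁, show Real.sin (θ / 4) ^ 4 = (Real.sin (θ / 4) ^ 2) ^ 2 by ring, hsin4]
    field_simp
  have hexp : Complex.exp (Complex.I * φ) * Complex.exp (-(Complex.I * φ)) = 1 := by
    rw [← Complex.exp_add, add_neg_cancel, Complex.exp_zero]
  have hsqc : ((Real.sin (θ / 2) : ℝ) : ℂ) ^ 2 = 1 - ((Real.cos (θ / 2) : ℝ) : ℂ) ^ 2 := by
    exact_mod_cast hsq
  have htrace : M.trace = (lam₀ : ℂ) + lam₁ := by
    rw [hM, hl₀, hl₁, Matrix.trace_smul, Matrix.trace_fin_two_of, smul_eq_mul]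
    push_cast [-Complex.ofReal_cos, -Complex.ofReal_sin]
    rw [hsqc]
    field_simp
    ring
  have hdet : M.det = (lam₀ : ℂ) * lam₁ := by
    rw [hM, hl₀, hl₁, Matrix.det_smul, Matrix.det_fin_two_of, Fintype.card_fin, hsin]
    push_cast [-Complex.ofReal_cos, -Complex.ofReal_sin]
    field_simp
    generalize ((Real.sin (θ / 2) : ℝ) : ℂ) = s at *
    generalize ((Real.cos (θ / 2) : ℝ) : ℂ) = c at *
    linear_combination (-4 * s ^ 2 * c ^ 2) * hexp + (s ^ 2 + 1 - c ^ 2) * hsqc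
  rw [Matrix.charpoly_fin_two, htrace, hdet, C_add, C_mul]
  ring
end

section
/- Fix a real number θ, set N = 1 + cos²(θ/2), λ₀ = (2/N)·cos⁴(θ/4), λ₁ = (2/N)·sin⁴(θ/4), and let M be the real symmetric 2×2 matrix M = (1/(2N))·[[4cos²(θ/2) + sin²(θ/2), sin θ], [sin θ, sin²(θ/2)]]. Then the vector v₀ = (cos(θ/4), sin(θ/4)) satisfies M·v₀ = λ₀·v₀ and the vector v₁ = (−sin(θ/4), cos(θ/4)) satisfies M·v₁ = λ₁·v₁. -/
theorem schmidt_eigenvectors (θ : ℝ)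
    (N : ℝ) (hN : N = 1 + Real.cos (θ / 2) ^ 2)
    (lam₀ lam₁ : ℝ)
    (h₀ : lam₀ = (2 / N) * Real.cos (θ / 4) ^ 4)
    (h₁ : lam₁ = (2 / N) * Real.sin (θ / 4) ^ 4)
    (M : Matrix (Fin 2) (Fin 2) ℝ)
    (hM : M = (1 / (2 * N)) •
      !![4 * Real.cos (θ / 2) ^ 2 + Real.sin (θ / 2) ^ 2, Real.sin θ;
         Real.sin θ, Real.sin (θ / 2) ^ 2])
    (v₀ v₁ : Fin 2 → ℝ)
    (hv₀ : v₀ = ![Real.cos (θ / 4), Real.sin (θ / 4)])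
    (hv₁ : v₁ = ![-Real.sin (θ / 4), Real.cos (θ / 4)]) :
    M.mulVec v₀ = lam₀ • v₀ ∧ M.mulVec v₁ = lam₁ • v₁ := by
  have hc : Real.cos (θ / 2) = Real.cos (θ / 4) ^ 2 - Real.sin (θ / 4) ^ 2 := by
    rw [← Real.cos_two_mul']
    ring_nf
  have hs : Real.sin (θ / 2) = 2 * Real.sin (θ / 4) * Real.cos (θ / 4) := by
    rw [← Real.sin_two_mul]
    ring_nf
  have hsin : Real.sin θ = 2 * Real.sin (θ / 2) * Real.cos (θ / 2) := by
    rw [← Real.sin_two_mul]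
    ring_nf
  subst h₀ h₁ hM hv₀ hv₁
  rw [hsin, hs, hc]
  constructor <;> ext i <;> fin_cases i <;>
    simp [Matrix.mulVec, dotProduct, Fin.sum_univ_two] <;> ring
end

section
/- Let e₀ = (1,0) and e₁ = (0,1) be the standard basis of ℝ², fix a real number θ, and set s = cos(θ/2)·e₀ + sin(θ/2)·e₁, N = 1 + cos²(θ/2), λ₀ = (2/N)·cos⁴(θ/4), λ₁ = (2/N)·sin⁴(θ/4), v₀ = cos(θ/4)·e₀ + sin(θ/4)·e₁, and v₁ = −sin(θ/4)·e₀ + cos(θ/4)·e₁. Then in the tensor product ℝ² ⊗ ℝ² one has √λ₀ · (v₀ ⊗ v₀) − √λ₁ · (v₁ ⊗ v₁) = (1/√(2N)) · (e₀ ⊗ s + s ⊗ e₀). -/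
open TensorProduct in
theorem schmidt_decomposition_symmetrized_state (θ : ℝ)
    (e₀ e₁ : Fin 2 → ℝ) (he₀ : e₀ = ![1, 0]) (he₁ : e₁ = ![0, 1])
    (s : Fin 2 → ℝ) (hs : s = Real.cos (θ / 2) • e₀ + Real.sin (θ / 2) • e₁)
    (N : ℝ) (hN : N = 1 + Real.cos (θ / 2) ^ 2)
    (lam₀ lam₁ : ℝ)
    (h₀ : lam₀ = (2 / N) * Real.cos (θ / 4) ^ 4)
    (h₁ : lam₁ = (2 / N) * Real.sin (θ / 4) ^ 4)
    (v₀ v₁ : Fin 2 → ℝ)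
    (hv₀ : v₀ = Real.cos (θ / 4) • e₀ + Real.sin (θ / 4) • e₁)
    (hv₁ : v₁ = -Real.sin (θ / 4) • e₀ + Real.cos (θ / 4) • e₁) :
    Real.sqrt lam₀ • (v₀ ⊗ₜ[ℝ] v₀) - Real.sqrt lam₁ • (v₁ ⊗ₜ[ℝ] v₁) =
      (1 / Real.sqrt (2 * N)) • (e₀ ⊗ₜ[ℝ] s + s ⊗ₜ[ℝ] e₀) := by
  have hsqrt (x : ℝ) : √(2 / N * x ^ 4) = 1 / √(2 * N) * (2 * x ^ 2) := by
    rw [show 2 / N * x ^ 4 = (2 * x ^ 2) ^ 2 / (2 * N) by ring, Real.sqrt_div (by positivity),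
      Real.sqrt_sq (by positivity)]
    ring
  have hsq := Real.sin_sq_add_cos_sq (θ / 4)
  have hθ : θ / 2 = 2 * (θ / 4) := by ring
  have hcos : Real.cos (θ / 2) = Real.cos (θ / 4) ^ 4 - Real.sin (θ / 4) ^ 4 := by
    rw [hθ, Real.cos_two_mul']
    linear_combination (Real.sin (θ / 4) ^ 2 - Real.cos (θ / 4) ^ 2) * hsq
  have hsin : Real.sin (θ / 2) =
      2 * Real.sin (θ / 4) * Real.cos (θ / 4) *
        (Real.sin (θ / 4) ^ 2 + Real.cos (θ / 4) ^ 2) := by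
    rw [hθ, Real.sin_two_mul, hsq, mul_one]
  rw [h₀, h₁, hsqrt, hsqrt, hs, hcos, hsin, hv₀, hv₁]
  simp only [TensorProduct.add_tmul, TensorProduct.tmul_add, ← TensorProduct.smul_tmul',
    TensorProduct.tmul_smul]
  module
end

section
/- For all real numbers p₁, p₂, q₁, q₂ with p₁² + p₂² = 1 and q₁² + q₂² = 1, one has p₁ + p₂ + q₁ − q₂ ≤ 2√2. -/
theorem add_le_sqrt_two_of_sq_add_sq_eq_one {x y : ℝ} (h : x ^ 2 + y ^ 2 = 1) :
    x + y ≤ Real.sqrt 2 :=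
  Real.le_sqrt_of_sq_le (by nlinarith [sq_nonneg (x - y)])

theorem chsh_coeff_bound (p₁ p₂ q₁ q₂ : ℝ)
    (hp : p₁ ^ 2 + p₂ ^ 2 = 1) (hq : q₁ ^ 2 + q₂ ^ 2 = 1) :
    p₁ + p₂ + q₁ - q₂ ≤ 2 * Real.sqrt 2 := by
  have hp' := add_le_sqrt_two_of_sq_add_sq_eq_one hp
  have hq' := add_le_sqrt_two_of_sq_add_sq_eq_one (x := q₁) (y := -q₂) (by rwa [neg_sq])
  linarith
end

section
/- For all real numbers x and y, |1 + sin x + sin y − sin x · sin y + cos x · cos y| ≤ 2√2. -/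
/-- The correlation function expressed through the half-sum and the half-difference of angles. -/
theorem correlation_eq_half_angles (x y : ℝ) :
    1 + Real.sin x + Real.sin y - Real.sin x * Real.sin y + Real.cos x * Real.cos y =
      2 + 2 * Real.sin ((x + y) / 2) * Real.cos ((x - y) / 2) - 2 * Real.sin ((x + y) / 2) ^ 2 := by
  have hsum : Real.sin x + Real.sin y =
      2 * Real.sin ((x + y) / 2) * Real.cos ((x - y) / 2) := by
    have hx : x = (x + y) / 2 + (x - y) / 2 := by ring
    have hy : y = (x + y) / 2 - (x - y) / 2 := by ring
    conv_lhs => rw [hx, hy, Real.sin_add, Real.sin_sub]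
    ring_nf
  have hcos : Real.cos (x + y) = 1 - 2 * Real.sin ((x + y) / 2) ^ 2 := by
    rw [← mul_div_cancel₀ (x + y) (two_ne_zero' ℝ), Real.cos_two_mul, Real.cos_sq']
    ring_nf
  linarith [Real.cos_add x y]

theorem correlation_bound_plus (x y : ℝ) :
    |1 + Real.sin x + Real.sin y - Real.sin x * Real.sin y +
      Real.cos x * Real.cos y| ≤ 2 * Real.sqrt 2 := by
  rw [correlation_eq_half_angles]
  have hs := Real.sin_sq_le_one ((x + y) / 2)
  have ht := Real.cos_sq_le_one ((x - y) / 2)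
  generalize Real.sin ((x + y) / 2) = s at *
  generalize Real.cos ((x - y) / 2) = t at *
  have hsqrt : (5 / 4 : ℝ) ≤ Real.sqrt 2 := Real.le_sqrt_of_sq_le (by norm_num)
  rw [abs_le]
  constructor
  · nlinarith [sq_nonneg (s + t)]
  · nlinarith [sq_nonneg (2 * s - t)]
end

section
/- For all real numbers x and y, |1 + sin x + sin y − sin x · sin y − cos x · cos y| ≤ 2√2. -/
theorem correlation_eq_half_angle (x y : ℝ) :
    1 + Real.sin x + Real.sin y - Real.sin x * Real.sin y - Real.cos x * Real.cos y =
      2 + 2 * (Real.sin ((x + y) / 2) * Real.cos ((x - y) / 2)) -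
        2 * Real.cos ((x - y) / 2) ^ 2 := by
  have hsum : Real.sin x + Real.sin y =
      2 * Real.sin ((x + y) / 2) * Real.cos ((x - y) / 2) := by
    rw [show x = (x + y) / 2 + (x - y) / 2 by ring,
      show y = (x + y) / 2 - (x - y) / 2 by ring, Real.sin_add, Real.sin_sub]
    ring_nf
  have hdiff : Real.cos (x - y) = 2 * Real.cos ((x - y) / 2) ^ 2 - 1 := by
    rw [← Real.cos_two_mul]
    ring_nf
  rw [Real.cos_sub] at hdiff
  linarith

theorem correlation_bound_minus (x y : ℝ) :
    |1 + Real.sin x + Real.sin y - Real.sin x * Real.sin y -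
      Real.cos x * Real.cos y| ≤ 2 * Real.sqrt 2 := by
  have hsqrt : (5 / 4 : ℝ) ≤ Real.sqrt 2 := Real.le_sqrt_of_sq_le (by norm_num)
  rw [correlation_eq_half_angle]
  have hs := Real.sin_sq_le_one ((x + y) / 2)
  have hc := Real.cos_sq_le_one ((x - y) / 2)
  generalize Real.sin ((x + y) / 2) = s at *
  generalize Real.cos ((x - y) / 2) = c at *
  rw [abs_le]
  constructor
  · nlinarith [sq_nonneg (s + c)]
  · nlinarith [sq_nonneg (s - 2 * c)]
end
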